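/- Let F : ℝ³ → (0,∞) be measurable with ∫_{ℝ³} F(1+|v|²) dv < ∞, with macroscopic fields ρ > 0, U ∈ ℝ³, T > 0, and let M = M(F) be its local Maxwellian. Assume that the functions (M − F)·log F and (M − F)·log M are integrable on ℝ³. Then ∫_{ℝ³} (M − F) log F dv ≤ 0; in particular, for every constant ν ≥ 0, ∫_{ℝ³} ν (M(F) − F) log F dv ≤ 0 (the entropy dissipation inequality for the BGK relaxation operator). -/

import Mathlib

noncomputable section
open Real MeasureTheory

abbrev E3 := EuclideanSpace ℝ (Fin 3)

/-- The Maxwellian with density `ρ`, bulk velocity `U` and temperature `T`. -/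
def maxwellian (ρ : ℝ) (U : E3) (T : ℝ) : E3 → ℝ :=
  fun v => ρ * (2 * π * T) ^ (-(3 : ℝ) / 2) * Real.exp (-‖v - U‖ ^ 2 / (2 * T))

/-- In dimension three, the second moment of a centred Gaussian is `3 * T` times its mass. -/
theorem integral_sq_norm_mul_exp {T : ℝ} (hT : 0 < T) :
    (∫ v : E3, ‖v‖ ^ 2 * Real.exp (-‖v‖ ^ 2 / (2 * T))) =
      3 * T * ∫ v : E3, Real.exp (-‖v‖ ^ 2 / (2 * T)) := by
  have radial (n : ℕ) :
      (∫ y in Set.Ioi (0 : ℝ), y ^ n * Real.exp (-y ^ 2 / (2 * T))) =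
        (1 / (2 * T)) ^ (-((n : ℝ) + 1) / 2) * (1 / 2) * Real.Gamma (((n : ℝ) + 1) / 2) := by
    have hn : (-1 : ℝ) < n := by linarith [(Nat.cast_nonneg n : (0 : ℝ) ≤ n)]
    rw [← integral_rpow_mul_exp_neg_mul_rpow (p := 2) two_pos hn
      (show 0 < 1 / (2 * T) by positivity)]
    refine setIntegral_congr_fun measurableSet_Ioi fun y _ => ?_
    simp only [rpow_natCast, rpow_two]
    ring_nf
  have hratio : (∫ y in Set.Ioi (0 : ℝ), y ^ 4 * Real.exp (-y ^ 2 / (2 * T))) =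
      3 * T * ∫ y in Set.Ioi (0 : ℝ), y ^ 2 * Real.exp (-y ^ 2 / (2 * T)) := by
    rw [radial, radial]
    have hGamma : Real.Gamma ((((4 : ℕ) : ℝ) + 1) / 2) =
        3 / 2 * Real.Gamma ((((2 : ℕ) : ℝ) + 1) / 2) := by
      rw [show ((((4 : ℕ) : ℝ) + 1) / 2) = 3 / 2 + 1 by norm_num,
        show ((((2 : ℕ) : ℝ) + 1) / 2) = 3 / 2 by norm_num, Real.Gamma_add_one (by norm_num)]
    have hpow : (1 / (2 * T)) ^ (-(((4 : ℕ) : ℝ) + 1) / 2) =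
        2 * T * (1 / (2 * T)) ^ (-(((2 : ℕ) : ℝ) + 1) / 2) := by
      rw [show -(((4 : ℕ) : ℝ) + 1) / 2 = -1 + -(((2 : ℕ) : ℝ) + 1) / 2 by norm_num,
        rpow_add (by positivity), rpow_neg_one, one_div, inv_inv]
    rw [hGamma, hpow]
    ring
  rw [integral_fun_norm_addHaar volume fun r : ℝ => r ^ 2 * Real.exp (-r ^ 2 / (2 * T)),
    integral_fun_norm_addHaar volume fun r : ℝ => Real.exp (-r ^ 2 / (2 * T))]
  simp only [finrank_euclideanSpace, Fintype.card_fin, smul_eq_mul, ← mul_assoc, ← pow_add,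
    nsmul_eq_mul]
  norm_num only
  rw [hratio]
  ring

theorem integral_exp_neg_sq_norm {T : ℝ} (hT : 0 < T) :
    (∫ v : E3, Real.exp (-‖v‖ ^ 2 / (2 * T))) = (2 * π * T) ^ ((3 : ℝ) / 2) := by
  have h := GaussianFourier.integral_rexp_neg_mul_sq_norm (V := E3)
    (show 0 < 1 / (2 * T) by positivity)
  simp only [finrank_euclideanSpace, Fintype.card_fin] at h
  convert h using 1
  · refine integral_congr_ae (.of_forall fun v => ?_)
    ring_nf
  · congr 1
    field_simp

theorem maxwellian_pos {ρ T : ℝ} (hρ : 0 < ρ) (hT : 0 < T) (U v : E3) :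
    0 < maxwellian ρ U T v := by
  unfold maxwellian
  positivity

theorem integral_maxwellian (ρ : ℝ) (U : E3) {T : ℝ} (hT : 0 < T) :
    (∫ v, maxwellian ρ U T v) = ρ := by
  have hpos : 0 < 2 * π * T := by positivity
  unfold maxwellian
  rw [integral_const_mul,
    integral_sub_right_eq_self (fun v : E3 => Real.exp (-‖v‖ ^ 2 / (2 * T))) U,
    integral_exp_neg_sq_norm hT, mul_assoc, ← rpow_add hpos]
  norm_num

theorem integral_maxwellian_mul_sq_norm (ρ : ℝ) (U : E3) {T : ℝ} (hT : 0 < T) :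
    (∫ v, maxwellian ρ U T v * ‖v - U‖ ^ 2) = 3 * T * ρ := by
  conv_rhs => rw [← integral_maxwellian ρ U hT]
  unfold maxwellian
  simp only [mul_assoc _ (Real.exp _)]
  rw [integral_const_mul, integral_const_mul,
    integral_sub_right_eq_self (fun v : E3 => Real.exp (-‖v‖ ^ 2 / (2 * T))) U,
    integral_sub_right_eq_self
      (fun v : E3 => Real.exp (-‖v‖ ^ 2 / (2 * T)) * ‖v‖ ^ 2) U]
  simp only [mul_comm (Real.exp _)]
  rw [integral_sq_norm_mul_exp hT]
  ring

theorem log_maxwellian {ρ T : ℝ} (hρ : 0 < ρ) (hT : 0 < T) (U v : E3) :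
    Real.log (maxwellian ρ U T v) =
      Real.log (ρ * (2 * π * T) ^ (-(3 : ℝ) / 2)) - ‖v - U‖ ^ 2 / (2 * T) := by
  unfold maxwellian
  rw [Real.log_mul (by positivity) (by positivity), Real.log_exp]
  ring

/-- Entropy dissipation for the BGK relaxation operator: if `M = M(F)` is the local
Maxwellian of a positive `F` with finite second moment, then `∫ (M − F) log F ≤ 0`,
and consequently `∫ ν (M − F) log F ≤ 0` for every constant `ν ≥ 0`. -/
theorem stmt3 (F : E3 → ℝ) (hFmeas : Measurable F) (hFpos : ∀ v, 0 < F v)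
    (hFint : Integrable (fun v => F v * (1 + ‖v‖ ^ 2)))
    (ρ : ℝ) (U : E3) (T : ℝ)
    (hρ : ρ = ∫ v, F v) (hρpos : 0 < ρ)
    (hU : U = ρ⁻¹ • ∫ v, F v • v)
    (hT : T = (∫ v, F v * ‖v - U‖ ^ 2) / (3 * ρ)) (hTpos : 0 < T)
    (hint1 : Integrable (fun v => (maxwellian ρ U T v - F v) * Real.log (F v)))
    (hint2 : Integrable (fun v => (maxwellian ρ U T v - F v) * Real.log (maxwellian ρ U T v))) :
    (∫ v, (maxwellian ρ U T v - F v) * Real.log (F v)) ≤ 0 ∧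
    ∀ ν : ℝ, 0 ≤ ν → (∫ v, ν * (maxwellian ρ U T v - F v) * Real.log (F v)) ≤ 0 := by
  have hMF : (∫ v, (maxwellian ρ U T v - F v) * Real.log (maxwellian ρ U T v)) = 0 := by
    have hF : Integrable F := .of_integral_ne_zero (by rw [← hρ]; exact hρpos.ne')
    have hF2 : Integrable fun v => F v * ‖v - U‖ ^ 2 := .of_integral_ne_zero fun h => by
      rw [h, zero_div] at hT
      exact hTpos.ne' hT
    have hM : Integrable (maxwellian ρ U T) :=
      .of_integral_ne_zero (by rw [integral_maxwellian ρ U hTpos]; exact hρpos.ne')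
    have hM2 : Integrable fun v => maxwellian ρ U T v * ‖v - U‖ ^ 2 :=
      .of_integral_ne_zero (by rw [integral_maxwellian_mul_sq_norm ρ U hTpos]; positivity)
    have hFT : (∫ v, F v * ‖v - U‖ ^ 2) = 3 * T * ρ := by
      rw [eq_div_iff (by positivity)] at hT
      linarith
    set c := Real.log (ρ * (2 * π * T) ^ (-(3 : ℝ) / 2)) with hc
    calc (∫ v, (maxwellian ρ U T v - F v) * Real.log (maxwellian ρ U T v))
        = ∫ v, (c * (maxwellian ρ U T v - F v) -
            (2 * T)⁻¹ * (maxwellian ρ U T v * ‖v - U‖ ^ 2 - F v * ‖v - U‖ ^ 2)) := by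
          refine integral_congr_ae (.of_forall fun v => ?_)
          simp only [log_maxwellian hρpos hTpos, ← hc]
          ring
      _ = 0 := by
          have h0 : Integrable fun v => c * (maxwellian ρ U T v - F v) :=
            (hM.sub hF).const_mul c
          have h2 : Integrable fun v => (2 * T)⁻¹ *
              (maxwellian ρ U T v * ‖v - U‖ ^ 2 - F v * ‖v - U‖ ^ 2) :=
            (hM2.sub hF2).const_mul _
          rw [integral_sub h0 h2,
            integral_const_mul, integral_const_mul, integral_sub hM hF, integral_sub hM2 hF2,
            integral_maxwellian ρ U hTpos, integral_maxwellian_mul_sq_norm ρ U hTpos, hFT, ← hρ]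
          ring
  have hmain : (∫ v, (maxwellian ρ U T v - F v) * Real.log (F v)) ≤ 0 := by
    rw [← hMF]
    refine integral_mono hint1 hint2 fun v => ?_
    have hMpos := maxwellian_pos hρpos hTpos U v
    rcases le_total (F v) (maxwellian ρ U T v) with h | h
    · exact mul_le_mul_of_nonneg_left (Real.log_le_log (hFpos v) h) (sub_nonneg.2 h)
    · exact mul_le_mul_of_nonpos_left (Real.log_le_log hMpos h) (sub_nonpos.2 h)
  refine ⟨hmain, fun ν hν => ?_⟩
  simp only [mul_assoc]
  rw [integral_const_mul]
  exact mul_nonpos_of_nonneg_of_nonpos hν hmain
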